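/- arXiv:math/0312182 — 8 statements merged into one kernel-verified Lean document; each statement's English description precedes it below -/
import Mathlib

section
/- Every σ-compact topological space X (i.e., X is a countable union of compact subsets) satisfies Sfin(Ω,Ω): for every sequence ⟨𝒰_n⟩_{n∈ℕ} of ω-covers of X there exist finite subsets ℱ_n ⊆ 𝒰_n such that ⋃_{n∈ℕ} ℱ_n is an ω-cover of X. -/
open Set Filter Topology

/-- A (nontrivial) cover of a space: the union is everything and the whole space
is not a member. -/
def IsCover {α : Type*} (𝒰 : Set (Set α)) : Prop :=
  ⋃₀ 𝒰 = Set.univ ∧ Set.univ ∉ 𝒰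

/-- An open cover: a cover all of whose members are open. -/
def IsOpenCover {α : Type*} [TopologicalSpace α] (𝒰 : Set (Set α)) : Prop :=
  IsCover 𝒰 ∧ ∀ U ∈ 𝒰, IsOpen U

/-- `𝒰` contains a finite subcover. -/
def HasFinSubcover {α : Type*} (𝒰 : Set (Set α)) : Prop :=
  ∃ ℱ ⊆ 𝒰, ℱ.Finite ∧ ⋃₀ ℱ = Set.univ

/-- A γ-cover: an infinite open cover such that every point belongs to all but
finitely many members. -/
def IsGammaCover {α : Type*} [TopologicalSpace α] (𝒰 : Set (Set α)) : Prop :=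
  IsOpenCover 𝒰 ∧ 𝒰.Infinite ∧ ∀ x : α, {U ∈ 𝒰 | x ∉ U}.Finite

/-- An ω-cover: an open cover such that every finite set is contained in some member. -/
def IsOmegaCover {α : Type*} [TopologicalSpace α] (𝒰 : Set (Set α)) : Prop :=
  IsOpenCover 𝒰 ∧ ∀ F : Set α, F.Finite → ∃ U ∈ 𝒰, F ⊆ U

/-- A large cover: an open cover such that every point belongs to infinitely many members. -/
def IsLargeCover {α : Type*} [TopologicalSpace α] (𝒰 : Set (Set α)) : Prop :=
  IsOpenCover 𝒰 ∧ ∀ x : α, {U ∈ 𝒰 | x ∈ U}.Infinite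

/-- A τ-cover: a large cover such that for all points `x, y`, one of the two
difference families is finite. -/
def IsTauCover {α : Type*} [TopologicalSpace α] (𝒰 : Set (Set α)) : Prop :=
  IsLargeCover 𝒰 ∧ ∀ x y : α,
    {U ∈ 𝒰 | x ∈ U ∧ y ∉ U}.Finite ∨ {U ∈ 𝒰 | y ∈ U ∧ x ∉ U}.Finite

/-- Every σ-compact space satisfies `Sfin(Ω,Ω)`. -/
theorem sigmaCompact_sfin_omega_omega {α : Type*} [TopologicalSpace α]
    (K : ℕ → Set α) (hK : ∀ n, IsCompact (K n)) (hKU : ⋃ n, K n = Set.univ)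
    (𝒰 : ℕ → Set (Set α)) (h : ∀ n, IsOmegaCover (𝒰 n)) :
    ∃ ℱ : ℕ → Set (Set α),
      (∀ n, (ℱ n).Finite ∧ ℱ n ⊆ 𝒰 n) ∧
      IsOmegaCover (⋃ n, ℱ n) := by
  classical
  have hne : Nonempty α := by
    by_contra hn
    rw [not_nonempty_iff] at hn
    obtain ⟨U, hU, -⟩ := (h 0).2 ∅ Set.finite_empty
    have : U = Set.univ := by ext x; exact hn.elim x
    exact (h 0).1.1.2 (this ▸ hU)
  obtain ⟨x0⟩ := hne
  have hC : ∀ n, IsCompact (Set.accumulate K n) := fun n => isCompact_accumulate hK n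
  have key : ∀ n, ∃ ℱ : Set (Set α), (ℱ.Finite ∧ ℱ ⊆ 𝒰 n) ∧
      ∀ f : Fin n → α, (∀ i, f i ∈ Set.accumulate K n) → ∃ U ∈ ℱ, ∀ i, f i ∈ U := by
    intro n
    have hc : IsCompact (Set.pi Set.univ (fun _ : Fin n => Set.accumulate K n)) :=
      isCompact_univ_pi fun _ => hC n
    obtain ⟨t, ht, htf, hcov⟩ := hc.elim_finite_subcover_image (b := 𝒰 n)
      (c := fun U => Set.pi Set.univ (fun _ : Fin n => U))
      (fun U hU => isOpen_set_pi Set.finite_univ fun _ _ => (h n).1.2 U hU)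
      (by
        intro f _
        obtain ⟨U, hU, hf⟩ := (h n).2 (Set.range f) (Set.finite_range f)
        exact Set.mem_biUnion hU fun i _ => hf ⟨i, rfl⟩)
    refine ⟨t, ⟨htf, ht⟩, fun f hf => ?_⟩
    obtain ⟨U, hU, hfU⟩ := Set.mem_iUnion₂.1 (hcov (fun i _ => hf i))
    exact ⟨U, hU, fun i => hfU i trivial⟩
  choose ℱ hℱ hcov using key
  have homega : ∀ F : Set α, F.Finite → ∃ U ∈ ⋃ n, ℱ n, F ⊆ U := by
    intro F hF
    have hex : ∀ x : α, ∃ n, x ∈ K n := fun x => by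
      have : x ∈ ⋃ n, K n := hKU ▸ Set.mem_univ x
      exact Set.mem_iUnion.1 this
    choose r hr using hex
    let G : Finset α := insert x0 hF.toFinset
    let l := G.toList
    let n := max l.length (G.sup r)
    obtain ⟨U, hU, hfU⟩ := hcov n (fun i => l.getD i x0) (by
      intro i
      have hmem : l.getD i x0 ∈ G := by
        by_cases hi : (i : ℕ) < l.length
        · rw [List.getD_eq_getElem _ _ hi]
          exact Finset.mem_toList.1 (List.getElem_mem hi)
        · rw [List.getD_eq_default _ _ (not_lt.1 hi)]
          exact Finset.mem_insert_self _ _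
      exact Set.mem_accumulate.2 ⟨_, (Finset.le_sup (f := r) hmem).trans (le_max_right _ _), hr _⟩)
    refine ⟨U, Set.mem_iUnion.2 ⟨n, hU⟩, fun x hx => ?_⟩
    have hxl : x ∈ l := Finset.mem_toList.2 (Finset.mem_insert_of_mem (hF.mem_toFinset.2 hx))
    obtain ⟨i, hi, rfl⟩ := List.mem_iff_getElem.1 hxl
    have := hfU ⟨i, hi.trans_le (le_max_left _ _)⟩
    exact (List.getD_eq_getElem l x0 hi) ▸ this
  refine ⟨ℱ, hℱ, ⟨⟨?_, ?_⟩, ?_⟩, homega⟩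
  · refine Set.eq_univ_of_forall fun x => ?_
    obtain ⟨U, hU, hx⟩ := homega {x} (Set.finite_singleton x)
    exact ⟨U, hU, hx rfl⟩
  · intro hu
    obtain ⟨n, hn⟩ := Set.mem_iUnion.1 hu
    exact (h n).1.1.2 ((hℱ n).2 hn)
  · intro U hU
    obtain ⟨n, hn⟩ := Set.mem_iUnion.1 hU
    exact (h n).1.2 U ((hℱ n).2 hn)
end

section
/- If X is an infinite T1 topological space, then X does not satisfy the property Λ-choose-Ω: there exists a large open cover 𝒰 of X such that no subfamily of 𝒰 is an ω-cover of X. -/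
open Set Filter Topology

/-- No infinite T1 space satisfies `Λ-choose-Ω`. -/
theorem not_lambda_choose_omega {α : Type*} [TopologicalSpace α] [T1Space α]
    [Infinite α] :
    ∃ 𝒰 : Set (Set α), IsLargeCover 𝒰 ∧ ¬ ∃ 𝒱 ⊆ 𝒰, IsOmegaCover 𝒱 := by
  classical
  obtain ⟨a, b, hab⟩ := exists_pair_ne α
  refine ⟨{U | IsOpen U ∧ ¬ (a ∈ U ∧ b ∈ U)}, ?_, ?_⟩
  · have key : ∀ x : α, {U ∈ {U : Set α | IsOpen U ∧ ¬ (a ∈ U ∧ b ∈ U)} | x ∈ U}.Infinite := by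
      intro x
      obtain ⟨c, hc, hxc⟩ : ∃ c, (c = a ∨ c = b) ∧ x ≠ c := by
        by_cases h : x = a
        · exact ⟨b, Or.inr rfl, h ▸ hab⟩
        · exact ⟨a, Or.inl rfl, h⟩
      have hinf : (({x, c} : Set α)ᶜ).Infinite := (Set.toFinite _).infinite_compl
      refine Set.infinite_of_injOn_mapsTo (f := fun y => ({c, y} : Set α)ᶜ) ?_ ?_ hinf
      · intro y hy z hz h
        have h' : ({c, y} : Set α) = {c, z} := compl_injective h
        have hy' : y ∈ ({c, z} : Set α) := h' ▸ (by simp)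
        simp only [mem_compl_iff, mem_insert_iff, mem_singleton_iff] at hy hy'
        tauto
      · intro y hy
        simp only [mem_compl_iff, mem_insert_iff, mem_singleton_iff, not_or] at hy
        refine ⟨⟨(Set.toFinite _).isClosed.isOpen_compl, ?_⟩, ?_⟩
        · rintro ⟨h1, h2⟩
          rcases hc with rfl | rfl
          · exact h1 (by simp)
          · exact h2 (by simp)
        · simp only [mem_compl_iff, mem_insert_iff, mem_singleton_iff, not_or]
          exact ⟨hxc, fun h => hy.1 h.symm⟩
    refine ⟨⟨⟨?_, ?_⟩, fun U hU => hU.1⟩, key⟩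
    · refine eq_univ_of_forall fun x => ?_
      obtain ⟨U, hU, hx⟩ := (key x).nonempty
      exact ⟨U, hU, hx⟩
    · rintro ⟨_, h⟩
      exact h ⟨mem_univ _, mem_univ _⟩
  · rintro ⟨V, hV, _, h⟩
    obtain ⟨U, hU, hF⟩ := h {a, b} (Set.toFinite _)
    exact (hV hU).2 ⟨hF (by simp), hF (by simp)⟩
end

section
/- (Gerlits–Nagy) For every set of reals X (a subset of ℝ with the subspace topology), the following are equivalent: (a) X satisfies S1(Ω,Γ): for every sequence ⟨𝒰_n⟩_{n∈ℕ} of ω-covers of X there exist U_n ∈ 𝒰_n (n ∈ ℕ) such that {U_n : n ∈ ℕ} is a γ-cover of X; (b) X satisfies Ω-choose-Γ: every ω-cover of X has a subfamily which is a γ-cover of X. -/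
open Set Filter Topology

/-- (Gerlits–Nagy) For sets of reals, `S1(Ω,Γ)` is equivalent to `Ω-choose-Γ`. -/
theorem s1_omega_gamma_iff_omega_choose_gamma (X : Set ℝ) :
    (∀ 𝒰 : ℕ → Set (Set X), (∀ n, IsOmegaCover (𝒰 n)) →
        ∃ U : ℕ → Set X, (∀ n, U n ∈ 𝒰 n) ∧ IsGammaCover (Set.range U)) ↔
    (∀ 𝒰 : Set (Set X), IsOmegaCover 𝒰 → ∃ 𝒱 ⊆ 𝒰, IsGammaCover 𝒱) := by
  constructor
  · intro h 𝒰 h𝒰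
    obtain ⟨U, hU, hG⟩ := h (fun _ => 𝒰) (fun _ => h𝒰)
    exact ⟨Set.range U, by rintro _ ⟨n, rfl⟩; exact hU n, hG⟩
  · intro h 𝒰 h𝒰
    have hinf : Infinite X := by
      by_contra hfin
      rw [not_infinite_iff_finite] at hfin
      obtain ⟨U, hU, hUs⟩ := (h𝒰 0).2 Set.univ Set.finite_univ
      rw [Set.univ_subset_iff] at hUs
      exact (h𝒰 0).1.1.2 (hUs ▸ hU)
    let x : ℕ ↪ X := Infinite.natEmbedding X
    let 𝒱 : Set (Set X) := {G | ∃ (n : ℕ) (u : ℕ → Set X),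
      (∀ i ≤ n, u i ∈ 𝒰 i) ∧ G = (⋂ i ∈ Set.Iic n, u i) \ {x n}}
    have h𝒱fin : ∀ F : Set X, F.Finite → ∃ U ∈ 𝒱, F ⊆ U := by
      intro F hF
      obtain ⟨n, hn⟩ : ∃ n, x n ∉ F := by
        by_contra hcon
        push Not at hcon
        exact Set.infinite_of_injective_forall_mem x.injective hcon hF
      choose u hu hFu using fun i => (h𝒰 i).2 F hF
      refine ⟨_, ⟨n, u, fun i _ => hu i, rfl⟩, fun y hy => ⟨?_, ?_⟩⟩
      · simp only [Set.mem_iInter]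
        exact fun i _ => hFu i hy
      · rintro rfl
        exact hn hy
    have h𝒱 : IsOmegaCover 𝒱 := by
      refine ⟨⟨⟨?_, ?_⟩, ?_⟩, h𝒱fin⟩
      · refine Set.eq_univ_of_forall fun y => ?_
        obtain ⟨U, hU, hy⟩ := h𝒱fin {y} (Set.finite_singleton y)
        exact ⟨U, hU, hy rfl⟩
      · rintro ⟨n, u, -, he⟩
        have : x n ∈ (Set.univ : Set X) := trivial
        rw [he] at this
        exact this.2 rfl
      · rintro _ ⟨n, u, hu, rfl⟩
        refine IsOpen.sdiff ?_ isClosed_singleton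
        exact (Set.finite_Iic n).isOpen_biInter fun i hi => (h𝒰 i).1.2 _ (hu i hi)
    obtain ⟨𝒢, h𝒢, -, hGinf, hGfin⟩ := h 𝒱 h𝒱
    choose! N u hu hGe using fun G (hG : G ∈ 𝒢) => h𝒢 hG
    have hex : ∀ m, ∃ G ∈ 𝒢, m ≤ N G := by
      intro m
      by_contra hcon
      push Not at hcon
      refine hGinf (Set.Finite.subset
        ((Set.finite_Iio m).biUnion fun n _ => hGfin (x n)) fun G hG => ?_)
      simp only [Set.mem_iUnion]
      refine ⟨N G, hcon G hG, hG, fun hx => ?_⟩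
      have hx2 := (hGe G hG).subset hx
      exact hx2.2 rfl
    choose G hG hm using hex
    have hmem : ∀ m, u (G m) m ∈ 𝒰 m := fun m => hu _ (hG m) m (hm m)
    have hsub : ∀ m, G m ⊆ u (G m) m := by
      intro m y hy
      rw [hGe _ (hG m)] at hy
      exact Set.mem_iInter₂.1 hy.1 m (hm m)
    have hfin : ∀ y, {m | y ∉ u (G m) m}.Finite := by
      intro y
      refine Set.Finite.subset
        ((hGfin y).biUnion fun g _ => Set.finite_Iic (N g)) fun m hy => ?_
      simp only [Set.mem_iUnion]
      exact ⟨G m, ⟨hG m, fun hh => hy (hsub m hh)⟩, hm m⟩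
    refine ⟨fun m => u (G m) m, hmem, ⟨⟨?_, ?_⟩, ?_⟩, ?_, ?_⟩
    · refine Set.eq_univ_of_forall fun y => ?_
      obtain ⟨m, hy⟩ := (hfin y).infinite_compl.nonempty
      exact ⟨_, ⟨m, rfl⟩, not_not.1 hy⟩
    · rintro ⟨m, he⟩
      exact (h𝒰 m).1.1.2 (he ▸ hmem m)
    · rintro _ ⟨m, rfl⟩
      exact (h𝒰 m).1.2 _ (hmem m)
    · intro hr
      have := hr.to_subtype
      obtain ⟨⟨V, m, hV⟩, hinfV⟩ :=
        Finite.exists_infinite_fiber (Set.rangeFactorization fun m => u (G m) m)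
      have hne : V ≠ Set.univ := fun he => (h𝒰 m).1.1.2 (he ▸ hV ▸ hmem m)
      obtain ⟨y, hy⟩ := (Set.ne_univ_iff_exists_notMem V).1 hne
      refine (Set.infinite_coe_iff.1 hinfV) ((hfin y).subset fun k hk => ?_)
      have hk' : u (G k) k = V := congrArg Subtype.val hk
      simpa [hk'] using hy
    · intro y
      refine ((hfin y).image fun m => u (G m) m).subset ?_
      rintro _ ⟨⟨m, rfl⟩, hy⟩
      exact ⟨m, hy, rfl⟩
end

section
/- For every set of reals X (a subset of ℝ with the subspace topology), the following are equivalent: (a) X satisfies the Menger property Ufin(Γ,O): for every sequence ⟨𝒰_n⟩_{n∈ℕ} of open covers of X there exist finite subsets ℱ_n ⊆ 𝒰_n such that ⋃_{n∈ℕ} ⋃ℱ_n = X; (b) X satisfies Sfin(Ω,O): for every sequence ⟨𝒰_n⟩_{n∈ℕ} of ω-covers of X there exist finite subsets ℱ_n ⊆ 𝒰_n such that ⋃_{n∈ℕ} ⋃ℱ_n = X. -/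
open Set Filter Topology

/-- For sets of reals, the Menger property `Ufin(Γ,O)` is equivalent to `Sfin(Ω,O)`. -/
theorem menger_iff_sfin_omega_open (X : Set ℝ) :
    (∀ 𝒰 : ℕ → Set (Set X), (∀ n, IsOpenCover (𝒰 n)) →
        ∃ ℱ : ℕ → Set (Set X), (∀ n, (ℱ n).Finite ∧ ℱ n ⊆ 𝒰 n) ∧
          ⋃ n, ⋃₀ ℱ n = Set.univ) ↔
    (∀ 𝒰 : ℕ → Set (Set X), (∀ n, IsOmegaCover (𝒰 n)) →
        ∃ ℱ : ℕ → Set (Set X), (∀ n, (ℱ n).Finite ∧ ℱ n ⊆ 𝒰 n) ∧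
          ⋃ n, ⋃₀ ℱ n = Set.univ) := by
  constructor
  · intro h 𝒰 h𝒰
    exact h 𝒰 fun n => (h𝒰 n).1
  · intro h 𝒰 h𝒰
    by_cases hfin : ∃ n, HasFinSubcover (𝒰 n)
    · obtain ⟨n, ℱ, hsub, hf, hcov⟩ := hfin
      refine ⟨fun m => {U | m = n ∧ U ∈ ℱ}, fun m => ⟨hf.subset fun U hU => hU.2, ?_⟩, ?_⟩
      · rintro U ⟨rfl, hU⟩
        exact hsub hU
      · refine Set.eq_univ_of_forall fun x => ?_
        have hx : x ∈ ⋃₀ ℱ := hcov ▸ Set.mem_univ x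
        obtain ⟨U, hU, hxU⟩ := hx
        exact Set.mem_iUnion.2 ⟨n, U, ⟨rfl, hU⟩, hxU⟩
    · have key : ∀ n, IsOmegaCover {V : Set X | ∃ ℱ ⊆ 𝒰 n, ℱ.Finite ∧ ⋃₀ ℱ = V} := by
        intro n
        have hpt : ∀ x : X, ∃ U ∈ 𝒰 n, x ∈ U := by
          intro x
          have hx : x ∈ ⋃₀ 𝒰 n := (h𝒰 n).1.1 ▸ Set.mem_univ x
          exact hx
        refine ⟨⟨⟨?_, fun hu => hfin ⟨n, hu⟩⟩, ?_⟩, ?_⟩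
        · refine Set.eq_univ_of_forall fun x => ?_
          obtain ⟨U, hU, hxU⟩ := hpt x
          exact ⟨U, ⟨{U}, by simpa using hU, Set.finite_singleton U, by simp⟩, hxU⟩
        · rintro V ⟨ℱ, hsub, -, rfl⟩
          exact isOpen_sUnion fun U hU => (h𝒰 n).2 U (hsub hU)
        · intro F hF
          choose f hf hxf using hpt
          refine ⟨⋃₀ (f '' F), ⟨f '' F, ?_, hF.image f, rfl⟩, ?_⟩
          · rintro _ ⟨x, -, rfl⟩
            exact hf x
          · intro x hx
            exact ⟨f x, ⟨x, hx, rfl⟩, hxf x⟩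
      obtain ⟨𝒢, h𝒢, hcov⟩ := h _ key
      choose g hg using fun n (V : 𝒢 n) => (h𝒢 n).2 V.2
      refine ⟨fun n => ⋃ V : 𝒢 n, g n V, fun n => ⟨?_, ?_⟩, ?_⟩
      · have := (h𝒢 n).1.to_subtype
        exact Set.finite_iUnion fun V => (hg n V).2.1
      · exact Set.iUnion_subset fun V => (hg n V).1
      · refine Set.eq_univ_of_forall fun x => ?_
        have hx : x ∈ ⋃ n, ⋃₀ 𝒢 n := hcov ▸ Set.mem_univ x
        obtain ⟨n, V, hV, hxV⟩ := Set.mem_iUnion.1 hx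
        have hx' : x ∈ ⋃₀ g n ⟨V, hV⟩ := by
          rw [(hg n ⟨V, hV⟩).2.2]
          exact hxV
        obtain ⟨U, hU, hxU⟩ := hx'
        exact Set.mem_iUnion.2 ⟨n, U, Set.mem_iUnion.2 ⟨⟨V, hV⟩, hU⟩, hxU⟩
end

section
/- For every set of reals X (a subset of ℝ with the subspace topology), the following are equivalent: (a) X satisfies Sfin(Ω,Ω): for every sequence ⟨𝒰_n⟩_{n∈ℕ} of ω-covers of X there exist finite subsets ℱ_n ⊆ 𝒰_n such that ⋃_{n∈ℕ} ℱ_n is an ω-cover of X; (b) for every k ∈ ℕ, the finite power X^k (with the product topology) satisfies the Menger property: for every sequence ⟨𝒰_n⟩_{n∈ℕ} of open covers of X^k there exist finite subsets ℱ_n ⊆ 𝒰_n such that ⋃_{n∈ℕ} ℱ_n covers X^k. -/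
open Set Filter Topology

/-- In a finite power, a neighbourhood of `F ^ k` (`F` finite) contains `V ^ k`
for some open `V ⊇ F`. -/
lemma exists_open_pow_subset (X : Set ℝ) (k : ℕ) (F : Set X) (hF : F.Finite)
    (W : Set (Fin k → X)) (hW : IsOpen W) (h : ∀ x : Fin k → X, (∀ i, x i ∈ F) → x ∈ W) :
    ∃ V : Set X, IsOpen V ∧ F ⊆ V ∧ ∀ x : Fin k → X, (∀ i, x i ∈ V) → x ∈ W := by
  have hc : IsCompact (Set.pi Set.univ (fun _ : Fin k => F)) :=
    isCompact_univ_pi fun _ => hF.isCompact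
  obtain ⟨δ, hδ, hsub⟩ := hc.exists_thickening_subset_open hW
    (fun x hx => h x fun i => hx i (Set.mem_univ i))
  refine ⟨Metric.thickening δ F, Metric.isOpen_thickening,
    Metric.self_subset_thickening hδ F, fun x hx => hsub ?_⟩
  have hx' : ∀ i, ∃ z ∈ F, dist (x i) z < δ := fun i => Metric.mem_thickening_iff.1 (hx i)
  choose z hz hd using hx'
  exact Metric.mem_thickening_iff.2 ⟨z, fun i _ => hz i, (dist_pi_lt_iff hδ).2 hd⟩

/-- Countable spaces are Menger. -/
lemma menger_of_countable {α : Type*} [TopologicalSpace α] [Countable α]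
    (𝒰 : ℕ → Set (Set α)) (h𝒰 : ∀ n, IsOpenCover (𝒰 n)) :
    ∃ ℱ : ℕ → Set (Set α), (∀ n, (ℱ n).Finite ∧ ℱ n ⊆ 𝒰 n) ∧
      ⋃ n, ⋃₀ ℱ n = Set.univ := by
  rcases isEmpty_or_nonempty α with he | hne
  · exact ⟨fun _ => ∅, fun n => ⟨Set.finite_empty, Set.empty_subset _⟩,
      Set.eq_univ_of_forall fun x => (he.false x).elim⟩
  · obtain ⟨f, hf⟩ := exists_surjective_nat α
    have hU : ∀ n, ∃ U ∈ 𝒰 n, f n ∈ U := fun n => by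
      have := (h𝒰 n).1.1 ▸ Set.mem_univ (f n)
      exact this
    choose U hU hm using hU
    refine ⟨fun n => {U n}, fun n => ⟨Set.finite_singleton _, by simpa using hU n⟩,
      Set.eq_univ_of_forall fun x => ?_⟩
    obtain ⟨n, rfl⟩ := hf x
    exact Set.mem_iUnion.2 ⟨n, U n, rfl, hm n⟩

/-- For sets of reals, `Sfin(Ω,Ω)` holds iff all finite powers have the Menger property. -/
theorem sfin_omega_omega_iff_powers_menger (X : Set ℝ) :
    (∀ 𝒰 : ℕ → Set (Set X), (∀ n, IsOmegaCover (𝒰 n)) →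
        ∃ ℱ : ℕ → Set (Set X), (∀ n, (ℱ n).Finite ∧ ℱ n ⊆ 𝒰 n) ∧
          IsOmegaCover (⋃ n, ℱ n)) ↔
    (∀ k : ℕ, ∀ 𝒰 : ℕ → Set (Set (Fin k → X)), (∀ n, IsOpenCover (𝒰 n)) →
        ∃ ℱ : ℕ → Set (Set (Fin k → X)), (∀ n, (ℱ n).Finite ∧ ℱ n ⊆ 𝒰 n) ∧
          ⋃ n, ⋃₀ ℱ n = Set.univ) := by
  constructor
  · intro ha k 𝒰 h𝒰
    rcases finite_or_infinite X with hfin | hinf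
    · exact menger_of_countable 𝒰 h𝒰
    let 𝒱 : ℕ → Set (Set X) := fun n => {V | IsOpen V ∧ V ≠ Set.univ ∧
      ∃ 𝒢 ⊆ 𝒰 n, 𝒢.Finite ∧ ∀ x : Fin k → X, (∀ i, x i ∈ V) → x ∈ ⋃₀ 𝒢}
    have hω : ∀ n, ∀ F : Set X, F.Finite → ∃ V ∈ 𝒱 n, F ⊆ V := by
      intro n F hF
      have hc : (Set.pi Set.univ (fun _ : Fin k => F)).Finite := Set.Finite.pi' (fun _ => hF) |>.subset
        (fun x hx i => hx i (Set.mem_univ i))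
      have hU : ∀ x : Fin k → X, ∃ U ∈ 𝒰 n, x ∈ U := fun x => by
        have := (h𝒰 n).1.1 ▸ Set.mem_univ x
        exact this
      choose U hU hm using hU
      obtain ⟨V, hVo, hFV, hV⟩ := exists_open_pow_subset X k F hF
        (⋃₀ (U '' (Set.pi Set.univ (fun _ : Fin k => F))))
        (isOpen_sUnion (by rintro _ ⟨x, -, rfl⟩; exact (h𝒰 n).2 _ (hU x)))
        (fun x hx => ⟨U x, ⟨x, fun i _ => hx i, rfl⟩, hm x⟩)
      obtain ⟨p, hp⟩ := hF.exists_notMem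
      refine ⟨V \ {p}, ⟨hVo.sdiff isClosed_singleton, ?_, _, ?_, hc.image U, ?_⟩, ?_⟩
      · intro h
        have : p ∈ V \ {p} := h ▸ Set.mem_univ p
        exact this.2 rfl
      · rintro _ ⟨x, -, rfl⟩
        exact hU x
      · exact fun x hx => hV x fun i => (hx i).1
      · exact fun y hy => ⟨hFV hy, fun h => hp (h ▸ hy)⟩
    obtain ⟨ℱ, hℱ, hcov⟩ := ha 𝒱 (fun n => by
      refine ⟨⟨⟨Set.eq_univ_of_forall fun x => ?_, fun h => h.2.1 rfl⟩, fun U hU => hU.1⟩, hω n⟩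
      obtain ⟨V, hV, hx⟩ := hω n {x} (Set.finite_singleton x)
      exact ⟨V, hV, hx rfl⟩)
    have hG : ∀ n, ∀ V : Set X, ∃ 𝒢 ⊆ 𝒰 n, 𝒢.Finite ∧
        (V ∈ ℱ n → ∀ x : Fin k → X, (∀ i, x i ∈ V) → x ∈ ⋃₀ 𝒢) := by
      intro n V
      by_cases hV : V ∈ ℱ n
      · obtain ⟨-, -, 𝒢, h1, h2, h3⟩ := (hℱ n).2 hV
        exact ⟨𝒢, h1, h2, fun _ => h3⟩
      · exact ⟨∅, Set.empty_subset _, Set.finite_empty, fun h => absurd h hV⟩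
    choose 𝒢 h1 h2 h3 using hG
    refine ⟨fun n => ⋃ V ∈ ℱ n, 𝒢 n V, fun n => ⟨(hℱ n).1.biUnion fun V _ => h2 n V,
      Set.iUnion₂_subset fun V _ => h1 n V⟩, Set.eq_univ_of_forall fun x => ?_⟩
    obtain ⟨V, hV, hxV⟩ := hcov.2 (Set.range x) (Set.finite_range x)
    obtain ⟨n, hn⟩ := Set.mem_iUnion.1 hV
    obtain ⟨U, hU, hxU⟩ := h3 n V hn x fun i => hxV ⟨i, rfl⟩
    exact Set.mem_iUnion.2 ⟨n, U, Set.mem_iUnion₂.2 ⟨V, hn, hU⟩, hxU⟩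
  · intro hb 𝒰 h𝒰
    let P : (k : ℕ) → Set X → Set (Fin (k + 1) → X) := fun k U => {x | ∀ i, x i ∈ U}
    have hM : ∀ k : ℕ, ∃ ℋ : ℕ → Set (Set X), (∀ m, (ℋ m).Finite ∧ ℋ m ⊆ 𝒰 (Nat.pair k m)) ∧
        ∀ x : Fin (k + 1) → X, ∃ m, ∃ U ∈ ℋ m, ∀ i, x i ∈ U := by
      intro k
      obtain ⟨ℱ, hℱ, hcov⟩ := hb (k + 1) (fun m => P k '' 𝒰 (Nat.pair k m)) (fun m => by
        refine ⟨⟨Set.eq_univ_of_forall fun x => ?_, ?_⟩, ?_⟩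
        · obtain ⟨U, hU, hx⟩ := (h𝒰 (Nat.pair k m)).2 (Set.range x) (Set.finite_range x)
          exact ⟨_, ⟨U, hU, rfl⟩, fun i => hx ⟨i, rfl⟩⟩
        · rintro ⟨U, hU, h⟩
          apply (h𝒰 (Nat.pair k m)).1.1.2
          have : U = Set.univ := Set.eq_univ_of_forall fun y => by
            have hy : (fun _ => y) ∈ P k U := h ▸ Set.mem_univ _
            exact hy 0
          exact this ▸ hU
        · rintro _ ⟨U, hU, rfl⟩
          have ho := (h𝒰 (Nat.pair k m)).1.2 U hU
          have : P k U = ⋂ i, (fun x : Fin (k + 1) → X => x i) ⁻¹' U := by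
            ext x; simp [P]
          rw [this]
          exact isOpen_iInter_of_finite fun i => ho.preimage (continuous_apply i))
      have hH : ∀ m, ∃ ℋ ⊆ 𝒰 (Nat.pair k m), ℋ.Finite ∧ ℱ m = P k '' ℋ := fun m =>
        Set.exists_subset_image_finite_and.1 ⟨ℱ m, (hℱ m).2, (hℱ m).1, rfl⟩
      choose ℋ hs hf he using hH
      refine ⟨ℋ, fun m => ⟨hf m, hs m⟩, fun x => ?_⟩
      obtain ⟨m, V, hV, hx⟩ := Set.mem_iUnion.1 (hcov ▸ Set.mem_univ x)
      rw [he m] at hV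
      obtain ⟨U, hU, rfl⟩ := hV
      exact ⟨m, U, hU, hx⟩
    choose ℋ hℋ hx using hM
    have hsub : ∀ n, ℋ n.unpair.1 n.unpair.2 ⊆ 𝒰 n := fun n => by
      have := (hℋ n.unpair.1 n.unpair.2).2
      rwa [Nat.pair_unpair] at this
    have hne : Nonempty X := by
      by_contra h
      obtain ⟨U, hU, -⟩ := (h𝒰 0).2 ∅ Set.finite_empty
      apply (h𝒰 0).1.1.2
      have : U = Set.univ := Set.eq_univ_of_forall fun y => (h ⟨y⟩).elim
      exact this ▸ hU
    have hω : ∀ F : Set X, F.Finite → ∃ U ∈ ⋃ n : ℕ, ℋ n.unpair.1 n.unpair.2, F ⊆ U := by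
      intro F hF
      obtain ⟨p⟩ := hne
      obtain ⟨k, f, hf⟩ := hF.fin_embedding
      obtain ⟨m, U, hU, hm⟩ := hx k (Fin.cons p f)
      refine ⟨U, Set.mem_iUnion.2 ⟨Nat.pair k m, by simpa using hU⟩, fun y hy => ?_⟩
      rw [← hf] at hy
      obtain ⟨i, rfl⟩ := hy
      simpa using hm i.succ
    refine ⟨fun n => ℋ n.unpair.1 n.unpair.2, fun n => ⟨(hℋ _ _).1, hsub n⟩,
      ⟨⟨Set.eq_univ_of_forall fun x => ?_, ?_⟩, ?_⟩, hω⟩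
    · obtain ⟨V, hV, hx⟩ := hω {x} (Set.finite_singleton x)
      exact ⟨V, hV, hx rfl⟩
    · intro h
      obtain ⟨n, hn⟩ := Set.mem_iUnion.1 h
      exact (h𝒰 n).1.1.2 (hsub n hn)
    · intro U hU
      obtain ⟨n, hn⟩ := Set.mem_iUnion.1 hU
      exact (h𝒰 n).1.2 U (hsub n hn)
end

section
/- Let X be a set of reals (a subset of ℝ with the subspace topology) such that every family B of functions ℕ → ℕ with |B| ≤ |X| is bounded with respect to eventual dominance (i.e., there exists g : ℕ → ℕ such that for every f ∈ B, f(n) ≤ g(n) for all but finitely many n). Then X satisfies S1(Γ,Γ): for every sequence ⟨𝒰_n⟩_{n∈ℕ} of γ-covers of X there exist U_n ∈ 𝒰_n (n ∈ ℕ) such that {U_n : n ∈ ℕ} is a γ-cover of X. -/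
open Set Filter Topology

/-- If every family of functions `ℕ → ℕ` of cardinality at most `|X|` is bounded
with respect to eventual dominance, then `X` satisfies `S1(Γ,Γ)`. -/
theorem small_unbounded_implies_s1_gamma_gamma (X : Set ℝ)
    (hb : ∀ B : Set (ℕ → ℕ), Cardinal.mk B ≤ Cardinal.mk X →
      ∃ g : ℕ → ℕ, ∀ f ∈ B, ∀ᶠ n in atTop, f n ≤ g n)
    (𝒰 : ℕ → Set (Set X)) (h : ∀ n, IsGammaCover (𝒰 n)) :
    ∃ U : ℕ → Set X, (∀ n, U n ∈ 𝒰 n) ∧ IsGammaCover (Set.range U) := by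
  let e : ∀ n, ℕ ↪ 𝒰 n := fun n => (h n).2.1.natEmbedding
  have hf : ∀ (x : X) (n : ℕ), ∃ k, ∀ m, k ≤ m → x ∈ (e n m : Set X) := by
    intro x n
    have hfin : {m | x ∉ (e n m : Set X)}.Finite := by
      refine Set.Finite.of_finite_image (f := fun m => (e n m : Set X)) ?_ ?_
      · refine ((h n).2.2 x).subset ?_
        rintro _ ⟨m, hm, rfl⟩
        exact ⟨(e n m).2, hm⟩
      · intro a _ b _ hab
        exact (e n).injective (Subtype.ext hab)
    obtain ⟨k, hk⟩ := hfin.bddAbove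
    refine ⟨k + 1, fun m hm => ?_⟩
    by_contra hx
    have : m ≤ k := hk hx
    omega
  choose f hf using hf
  obtain ⟨g, hg⟩ := hb (Set.range f) Cardinal.mk_range_le
  let U : ℕ → Set X := fun n => (e n (g n) : Set X)
  have hU : ∀ n, U n ∈ 𝒰 n := fun n => (e n (g n)).2
  have hev : ∀ x : X, ∀ᶠ n in atTop, x ∈ U n := fun x =>
    (hg (f x) ⟨x, rfl⟩).mono fun n hn => hf x n _ hn
  have hne : ∀ n, U n ≠ Set.univ := fun n hn => (h n).1.1.2 (hn ▸ hU n)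
  refine ⟨U, hU, ⟨⟨?_, ?_⟩, ?_⟩, ?_, ?_⟩
  · refine Set.eq_univ_of_forall fun x => ?_
    obtain ⟨n, hn⟩ := (hev x).exists
    exact ⟨U n, ⟨n, rfl⟩, hn⟩
  · rintro ⟨n, hn⟩
    exact hne n hn
  · rintro _ ⟨n, rfl⟩
    exact (h n).1.2 _ (hU n)
  · intro hfin
    -- a member occurring infinitely often would be the whole space
    have : Finite (Set.range U) := hfin
    obtain ⟨⟨V, k, hk⟩, hV⟩ := Finite.exists_infinite_fiber (Set.rangeFactorization U)
    have hV' := Nat.frequently_atTop_iff_infinite.2 (Set.infinite_coe_iff.1 hV)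
    apply hne k
    refine Set.eq_univ_of_forall fun x => ?_
    obtain ⟨n, hn, hx⟩ := (hV'.and_eventually (hev x)).exists
    have h1 : U n = V := congrArg Subtype.val hn
    rw [hk, ← h1]
    exact hx
  · intro x
    have hfin : {n | x ∉ U n}.Finite := by
      have := hev x
      rw [← Nat.cofinite_eq_atTop] at this
      exact this
    refine (hfin.image U).subset ?_
    rintro _ ⟨⟨n, rfl⟩, hx⟩
    exact ⟨n, hx, rfl⟩
end

section
/- Let X be a set of reals (a subset of ℝ with the subspace topology). If X satisfies the Rothberger property S1(O,O) (for every sequence ⟨𝒰_n⟩ of open covers of X there exist U_n ∈ 𝒰_n with ⋃_n U_n = X), or X satisfies the Hurewicz property Ufin(Γ,Γ) (for every sequence ⟨𝒰_n⟩ of open covers of X, none containing a finite subcover, there exist finite ℱ_n ⊆ 𝒰_n such that every x ∈ X belongs to ⋃ℱ_n for all but finitely many n), then X satisfies Split(Λ,Λ): every large cover of X can be split into two disjoint subfamilies each of which contains a large cover of X as a subfamily. -/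
open Set Filter Topology

theorem aux_large_of_subset {α : Type*} [TopologicalSpace α] {𝒰 𝒢 : Set (Set α)}
    (hU : IsLargeCover 𝒰) (hs : 𝒢 ⊆ 𝒰) (hi : ∀ x : α, {U ∈ 𝒢 | x ∈ U}.Infinite) :
    IsLargeCover 𝒢 := by
  refine ⟨⟨⟨?_, fun h => hU.1.1.2 (hs h)⟩, fun U h => hU.1.2 U (hs h)⟩, hi⟩
  refine Set.eq_univ_of_forall fun x => ?_
  obtain ⟨U, hU1, hU2⟩ := (hi x).nonempty
  exact ⟨U, hU1, hU2⟩

/-- Greedy choice of distinct representatives. -/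
theorem aux_sdr {β : Type*} (G : ℕ → Finset β) (hG : ∀ m, m < (G m).card) :
    ∃ c : ℕ → β, Function.Injective c ∧ ∀ m, c m ∈ G m := by
  classical
  refine (Finset.all_card_le_biUnion_card_iff_exists_injective G).1 fun s => ?_
  rcases s.eq_empty_or_nonempty with rfl | hs
  · simp
  · have h1 : s ⊆ Finset.range (s.max' hs + 1) := fun i hi => by
      have := s.le_max' i hi
      simp; omega
    have h2 := Finset.card_le_card h1
    rw [Finset.card_range] at h2
    have h3 : G (s.max' hs) ⊆ s.biUnion G :=
      Finset.subset_biUnion_of_mem G (s.max'_mem hs)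
    have h4 := Finset.card_le_card h3
    have h5 := hG (s.max' hs)
    omega

theorem aux_rothberger {α : Type*} [TopologicalSpace α]
    (h : ∀ 𝒰 : ℕ → Set (Set α), (∀ n, IsOpenCover (𝒰 n)) →
            ∃ U : ℕ → Set α, (∀ n, U n ∈ 𝒰 n) ∧ ⋃ n, U n = Set.univ)
    (𝒰 : Set (Set α)) (hU : IsLargeCover 𝒰) :
    ∃ 𝒱 𝒲 : Set (Set α), 𝒱 ⊆ 𝒰 ∧ 𝒲 ⊆ 𝒰 ∧ 𝒱 ∩ 𝒲 = ∅ ∧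
        IsLargeCover 𝒱 ∧ IsLargeCover 𝒲 := by
  classical
  let C : ℕ → Set (Set α) := fun m =>
    {V | ∃ F : Finset (Set α), (↑F : Set (Set α)) ⊆ 𝒰 ∧ F.card = 2 * m + 2 ∧ V = ⋂₀ (↑F : Set (Set α))}
  have hC : ∀ m, IsOpenCover (C m) := by
    intro m
    refine ⟨⟨Set.eq_univ_of_forall fun x => ?_, ?_⟩, ?_⟩
    · obtain ⟨F, hF, hc⟩ := (hU.2 x).exists_subset_card_eq (2 * m + 2)
      exact ⟨_, ⟨F, fun U hUF => (hF hUF).1, hc, rfl⟩, fun U hUF => (hF hUF).2⟩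
    · rintro ⟨F, hF, hc, hV⟩
      have hne : F.Nonempty := Finset.card_pos.1 (by omega)
      obtain ⟨U, hUF⟩ := hne
      have : U = Set.univ := by
        rw [Set.eq_univ_iff_forall]
        intro x
        have hx : x ∈ ⋂₀ (↑F : Set (Set α)) := hV ▸ Set.mem_univ x
        exact hx U hUF
      exact hU.1.1.2 (this ▸ hF hUF)
    · rintro V ⟨F, hF, hc, rfl⟩
      exact F.finite_toSet.isOpen_sInter fun U hUF => hU.1.2 U (hF hUF)
  have hk : ∀ k : ℕ, ∃ U : ℕ → Set α, (∀ n, U n ∈ C (Nat.pair k n)) ∧ ⋃ n, U n = Set.univ :=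
    fun k => h _ fun n => hC _
  choose V hV hVc using hk
  have hV' : ∀ i : ℕ, ∃ F : Finset (Set α), (↑F : Set (Set α)) ⊆ 𝒰 ∧ F.card = 2 * i + 2 ∧
      V i.unpair.1 i.unpair.2 = ⋂₀ (↑F : Set (Set α)) := by
    intro i
    have := hV i.unpair.1 i.unpair.2
    rwa [Nat.pair_unpair] at this
  choose F hFU hFc hFV using hV'
  obtain ⟨c, hci, hcF⟩ := aux_sdr (fun m => F (m / 2)) (fun m => by
    simp only [hFc]; omega)
  have hcU : ∀ m, c m ∈ 𝒰 := fun m => hFU _ (hcF m)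
  have key : ∀ e : ℕ → ℕ, Function.Injective e → (∀ i, e i / 2 = i) →
      IsLargeCover (Set.range fun i => c (e i)) := by
    intro e he hei
    refine aux_large_of_subset hU (by rintro _ ⟨i, rfl⟩; exact hcU _) fun x => ?_
    have hx : ∀ k, ∃ n, x ∈ V k n := fun k => by
      have : x ∈ ⋃ n, V k n := by rw [hVc]; trivial
      simpa using this
    choose n hn using hx
    refine Set.infinite_of_injective_forall_mem (f := fun k => c (e (Nat.pair k (n k)))) ?_ ?_
    · intro k l hkl
      have := he (hci hkl)
      exact (Nat.pair_eq_pair.1 this).1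
    · intro k
      refine ⟨⟨_, rfl⟩, ?_⟩
      have h1 := hcF (e (Nat.pair k (n k)))
      simp only [hei] at h1
      have h2 := hFV (Nat.pair k (n k))
      simp only [Nat.unpair_pair] at h2
      have h3 := hn k
      rw [h2] at h3
      exact h3 _ h1
  refine ⟨Set.range fun i => c (2 * i), Set.range fun i => c (2 * i + 1), ?_, ?_, ?_,
    key _ ?_ ?_, key _ ?_ ?_⟩
  · rintro _ ⟨i, rfl⟩; exact hcU _
  · rintro _ ⟨i, rfl⟩; exact hcU _
  · rw [Set.eq_empty_iff_forall_notMem]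
    rintro _ ⟨⟨i, rfl⟩, ⟨j, hj⟩⟩
    have := hci hj
    omega
  · intro i j hij; grind
  · intro i; omega
  · intro i j hij; grind
  · intro i; omega

/-- In a second countable space a large cover contains a countable large cover. -/
theorem aux_countable {α : Type*} [TopologicalSpace α] [SecondCountableTopology α]
    (𝒰 : Set (Set α)) (hU : IsLargeCover 𝒰) :
    ∃ 𝒱 ⊆ 𝒰, 𝒱.Countable ∧ IsLargeCover 𝒱 := by
  classical
  obtain ⟨B, hBc, -, hB⟩ := TopologicalSpace.exists_countable_basis α
  have hsel : ∀ b : Set α, ∃ S ⊆ {U ∈ 𝒰 | b ⊆ U}, S.Countable ∧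
      ({U ∈ 𝒰 | b ⊆ U}.Infinite → S.Infinite) ∧
      (¬ {U ∈ 𝒰 | b ⊆ U}.Infinite → S = {U ∈ 𝒰 | b ⊆ U}) := by
    intro b
    by_cases hb : {U ∈ 𝒰 | b ⊆ U}.Infinite
    · refine ⟨Set.range fun n => (hb.natEmbedding _ n : Set α), ?_, Set.countable_range _, ?_,
        fun h => absurd hb h⟩
      · rintro _ ⟨n, rfl⟩
        exact (hb.natEmbedding _ n).2
      · intro _
        exact Set.infinite_range_of_injective
          (Subtype.val_injective.comp (hb.natEmbedding _).injective)
    · exact ⟨_, Set.Subset.rfl, (Set.not_infinite.1 hb).countable, fun h => absurd h hb,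
        fun _ => rfl⟩
  choose S hS hSc hSi hSf using hsel
  have hsub : (⋃ b ∈ B, S b) ⊆ 𝒰 := by
    intro U hUm
    simp only [Set.mem_iUnion] at hUm
    obtain ⟨b, -, hb⟩ := hUm
    exact (hS b hb).1
  refine ⟨⋃ b ∈ B, S b, hsub, hBc.biUnion fun b _ => hSc b, aux_large_of_subset hU hsub fun x => ?_⟩
  by_cases hx : ∃ b ∈ B, x ∈ b ∧ {U ∈ 𝒰 | b ⊆ U}.Infinite
  · obtain ⟨b, hbB, hxb, hb⟩ := hx
    exact (hSi b hb).mono fun U hUb => ⟨Set.mem_biUnion hbB hUb, (hS b hUb).2 hxb⟩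
  · refine (hU.2 x).mono ?_
    rintro U ⟨hU1, hU2⟩
    refine ⟨?_, hU2⟩
    obtain ⟨b, hbB, hxb, hbU⟩ := hB.exists_subset_of_mem_open hU2 (hU.1.2 U hU1)
    refine Set.mem_biUnion hbB ?_
    rw [hSf b fun hi => hx ⟨b, hbB, hxb, hi⟩]
    exact ⟨hU1, hbU⟩

theorem aux_hurewicz {α : Type*} [TopologicalSpace α] [SecondCountableTopology α]
    (h : ∀ 𝒰 : ℕ → Set (Set α),
            (∀ n, IsOpenCover (𝒰 n) ∧ ¬ HasFinSubcover (𝒰 n)) →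
            ∃ ℱ : ℕ → Set (Set α), (∀ n, (ℱ n).Finite ∧ ℱ n ⊆ 𝒰 n) ∧
              ∀ x : α, ∀ᶠ n in atTop, x ∈ ⋃₀ ℱ n)
    (𝒰 : Set (Set α)) (hU : IsLargeCover 𝒰) :
    ∃ 𝒱 𝒲 : Set (Set α), 𝒱 ⊆ 𝒰 ∧ 𝒲 ⊆ 𝒰 ∧ 𝒱 ∩ 𝒲 = ∅ ∧
        IsLargeCover 𝒱 ∧ IsLargeCover 𝒲 := by
  classical
  obtain ⟨𝒞, hCU, hCc, hC⟩ := aux_countable 𝒰 hU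
  obtain ⟨f, hf⟩ := Set.countable_iff_exists_injOn.1 hCc
  let T : ℕ → Set (Set α) := fun n => {U ∈ 𝒞 | n ≤ f U}
  have hTlt : ∀ n, {U ∈ 𝒞 | f U < n}.Finite := fun n =>
    Set.Finite.of_finite_image (f := f)
      ((Set.finite_lt_nat n).subset (by rintro _ ⟨U, hU, rfl⟩; exact hU.2))
      (hf.mono fun U hU => hU.1)
  have hT : ∀ n, IsOpenCover (T n) := fun n => by
    refine (aux_large_of_subset hC (fun U hU => hU.1) fun x => ?_).1
    refine ((hC.2 x).sdiff (hTlt n)).mono ?_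
    rintro U ⟨⟨h1, h2⟩, h3⟩
    exact ⟨⟨h1, not_lt.1 fun h4 => h3 ⟨h1, h4⟩⟩, h2⟩
  have hF : ∃ ℱ : ℕ → Set (Set α), (∀ n, (ℱ n).Finite ∧ ℱ n ⊆ T n) ∧
      ∀ x : α, ∀ᶠ n in atTop, x ∈ ⋃₀ ℱ n := by
    by_cases hfs : ∀ n, HasFinSubcover (T n)
    · choose ℱ h1 h2 h3 using hfs
      exact ⟨ℱ, fun n => ⟨h2 n, h1 n⟩, fun x => Filter.Eventually.of_forall fun n => by
        rw [h3 n]; trivial⟩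
    · push Not at hfs
      obtain ⟨n₀, hn₀⟩ := hfs
      obtain ⟨ℱ, h1, h2⟩ := h (fun n => T (n₀ + n)) fun n => ⟨hT _, fun ⟨G, hG, hG'⟩ =>
        hn₀ ⟨G, fun U hU => ⟨(hG hU).1, le_trans (Nat.le_add_right _ _) (hG hU).2⟩, hG'⟩⟩
      exact ⟨ℱ, fun n => ⟨(h1 n).1, fun U hU => ⟨((h1 n).2 hU).1,
        le_trans (Nat.le_add_left _ _) ((h1 n).2 hU).2⟩⟩, h2⟩
  obtain ⟨ℱ, hℱ, hx⟩ := hF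
  have hg : ∀ n, ∃ g, n < g ∧ ∀ U ∈ ℱ n, f U < g := fun n => by
    obtain ⟨M, hM⟩ := ((hℱ n).1.image f).bddAbove
    refine ⟨max n M + 1, by omega, fun U hU => ?_⟩
    have := hM (Set.mem_image_of_mem f hU)
    omega
  choose g hg1 hg2 using hg
  let s : ℕ → ℕ := fun j => g^[j] 0
  have hs1 : ∀ j, s (j + 1) = g (s j) := fun j => Function.iterate_succ_apply' g j 0
  have hs : StrictMono s := strictMono_nat_of_lt_succ fun j => by rw [hs1]; exact hg1 _
  have hsub : ∀ n, ℱ n ⊆ 𝒰 := fun n U hU => hCU ((hℱ n).2 hU).1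
  have hdisj : ∀ i j U, i < j → U ∈ ℱ (s i) → U ∈ ℱ (s j) → False := fun i j U hij h1 h2 => by
    have h3 := hg2 _ U h1
    have h4 := ((hℱ _).2 h2).2
    have h5 : s (i + 1) ≤ s j := hs.monotone hij
    rw [hs1] at h5
    omega
  have key : ∀ e : ℕ → ℕ, StrictMono e → IsLargeCover (⋃ i, ℱ (s (e i))) := by
    intro e he
    refine aux_large_of_subset hU (Set.iUnion_subset fun i => hsub _) fun x hfin => ?_
    obtain ⟨M, hM⟩ := (hfin.image f).bddAbove
    have hse := (hs.comp he).tendsto_atTop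
    obtain ⟨i, ⟨U, hU1, hU2⟩, hi⟩ :=
      ((hse.eventually (hx x)).and (hse.eventually_gt_atTop M)).exists
    have h1 := hM (Set.mem_image_of_mem f (⟨Set.mem_iUnion.2 ⟨i, hU1⟩, hU2⟩ :
      U ∈ {U ∈ ⋃ i, ℱ (s (e i)) | x ∈ U}))
    have h2 := ((hℱ _).2 hU1).2
    simp only [Function.comp] at hi h2
    omega
  refine ⟨⋃ i, ℱ (s (2 * i)), ⋃ i, ℱ (s (2 * i + 1)), Set.iUnion_subset fun i => hsub _,
    Set.iUnion_subset fun i => hsub _, ?_, key (fun i => 2 * i) ?_, key (fun i => 2 * i + 1) ?_⟩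
  · rw [Set.eq_empty_iff_forall_notMem]
    rintro U ⟨h1, h2⟩
    obtain ⟨i, hi⟩ := Set.mem_iUnion.1 h1
    obtain ⟨j, hj⟩ := Set.mem_iUnion.1 h2
    rcases lt_or_ge (2 * i) (2 * j + 1) with hlt | hge
    · exact hdisj _ _ U hlt hi hj
    · exact hdisj _ _ U (by omega) hj hi
  · intro i j hij; simp only; omega
  · intro i j hij; simp only; omega

/-- Rothberger's property and the Hurewicz property each imply `Split(Λ,Λ)`. -/
theorem rothberger_or_hurewicz_implies_split_large_large (X : Set ℝ)
    (h : (∀ 𝒰 : ℕ → Set (Set X), (∀ n, IsOpenCover (𝒰 n)) →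
            ∃ U : ℕ → Set X, (∀ n, U n ∈ 𝒰 n) ∧ ⋃ n, U n = Set.univ) ∨
         (∀ 𝒰 : ℕ → Set (Set X),
            (∀ n, IsOpenCover (𝒰 n) ∧ ¬ HasFinSubcover (𝒰 n)) →
            ∃ ℱ : ℕ → Set (Set X), (∀ n, (ℱ n).Finite ∧ ℱ n ⊆ 𝒰 n) ∧
              ∀ x : X, ∀ᶠ n in atTop, x ∈ ⋃₀ ℱ n)) :
    ∀ 𝒰 : Set (Set X), IsLargeCover 𝒰 →
      ∃ 𝒱 𝒲 : Set (Set X), 𝒱 ⊆ 𝒰 ∧ 𝒲 ⊆ 𝒰 ∧ 𝒱 ∩ 𝒲 = ∅ ∧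
        (∃ 𝒢 ⊆ 𝒱, IsLargeCover 𝒢) ∧ (∃ 𝒢 ⊆ 𝒲, IsLargeCover 𝒢) := by
  intro 𝒰 hU
  have hmain : ∃ 𝒱 𝒲 : Set (Set X), 𝒱 ⊆ 𝒰 ∧ 𝒲 ⊆ 𝒰 ∧ 𝒱 ∩ 𝒲 = ∅ ∧
      IsLargeCover 𝒱 ∧ IsLargeCover 𝒲 := by
    rcases h with h | h
    · exact aux_rothberger h 𝒰 hU
    · exact aux_hurewicz h 𝒰 hU
  obtain ⟨𝒱, 𝒲, h1, h2, h3, h4, h5⟩ := hmain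
  exact ⟨𝒱, 𝒲, h1, h2, h3, ⟨𝒱, Set.Subset.rfl, h4⟩, ⟨𝒲, Set.Subset.rfl, h5⟩⟩
end

section
/- For every set of reals X (a subset of ℝ with the subspace topology), the following are equivalent: (a) X satisfies the Hurewicz property Ufin(Γ,Γ): for every sequence ⟨𝒰_n⟩_{n∈ℕ} of open covers of X, none containing a finite subcover, there exist finite subsets ℱ_n ⊆ 𝒰_n such that every x ∈ X belongs to ⋃ℱ_n for all but finitely many n; (b) X satisfies Sfin(Ω,O^{γ-gp}): for every sequence ⟨𝒰_n⟩_{n∈ℕ} of ω-covers of X there exist finite subsets ℱ_n ⊆ 𝒰_n such that ⋃_{n∈ℕ} ℱ_n is a γ-groupable cover of X. -/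
open Set Filter Topology

/-- A γ-groupable cover: a cover admitting a partition into pairwise disjoint
finite groups such that every point is in the union of all but finitely many groups. -/
def IsGammaGroupable {α : Type*} (𝒰 : Set (Set α)) : Prop :=
  IsCover 𝒰 ∧ ∃ 𝒢 : ℕ → Set (Set α),
    (∀ k, (𝒢 k).Finite) ∧ (∀ k l, k ≠ l → Disjoint (𝒢 k) (𝒢 l)) ∧
    (⋃ k, 𝒢 k) = 𝒰 ∧ ∀ x : α, ∀ᶠ k in atTop, x ∈ ⋃₀ 𝒢 k

theorem omega_large {α : Type*} [TopologicalSpace α] {𝒰 : Set (Set α)} (h : IsOmegaCover 𝒰)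
    (x : α) : {U ∈ 𝒰 | x ∈ U}.Infinite := by
  intro hfin
  have hne : ∀ U : Set α, ∃ y : α, U ∈ 𝒰 → y ∉ U := by
    intro U
    by_cases hU : U ∈ 𝒰
    · have : U ≠ univ := fun e => h.1.1.2 (e ▸ hU)
      obtain ⟨y, hy⟩ := (Set.ne_univ_iff_exists_notMem U).1 this
      exact ⟨y, fun _ => hy⟩
    · exact ⟨x, fun h' => absurd h' hU⟩
  choose y hy using hne
  obtain ⟨U, hU, hF⟩ := h.2 (insert x (y '' {U ∈ 𝒰 | x ∈ U})) ((hfin.image y).insert x)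
  have hx : x ∈ U := hF (mem_insert _ _)
  exact hy U hU (hF (mem_insert_of_mem _ (mem_image_of_mem y ⟨hU, hx⟩)))

theorem countable_large {α : Type*} [TopologicalSpace α] [SecondCountableTopology α]
    {𝒰 : Set (Set α)} (ho : ∀ U ∈ 𝒰, IsOpen U) (h : ∀ x, {U ∈ 𝒰 | x ∈ U}.Infinite) :
    ∃ 𝒱 ⊆ 𝒰, 𝒱.Countable ∧ ∀ x, {U ∈ 𝒱 | x ∈ U}.Infinite := by
  have h1 : ∀ (k : ℕ) (x : α), ∃ S : Finset (Set α), (S : Set (Set α)) ⊆ {U ∈ 𝒰 | x ∈ U} ∧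
      S.card = k := fun k x => (h x).exists_subset_card_eq k
  choose S hS hc using h1
  have h2 : ∀ k, ∃ s : Set α, s.Countable ∧ ⋃ x ∈ s, ⋂₀ (S k x : Set (Set α)) = univ := by
    intro k
    apply TopologicalSpace.countable_cover_nhds
    intro x
    apply IsOpen.mem_nhds
    · exact (S k x).finite_toSet.isOpen_sInter (fun U hU => ho U (hS k x hU).1)
    · exact fun U hU => (hS k x hU).2
  choose s hs hu using h2
  refine ⟨⋃ k, ⋃ x ∈ s k, (S k x : Set (Set α)), ?_, ?_, ?_⟩
  · intro U hU
    simp only [mem_iUnion] at hU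
    obtain ⟨k, x, _, hU⟩ := hU
    exact (hS k x hU).1
  · exact countable_iUnion fun k => (hs k).biUnion fun x _ => (S k x).countable_toSet
  · intro x hfin
    have hx : x ∈ ⋃ z ∈ s (hfin.toFinset.card + 1),
      ⋂₀ (S (hfin.toFinset.card + 1) z : Set (Set α)) := by rw [hu]; trivial
    obtain ⟨z, hz, hx⟩ := mem_iUnion₂.1 hx
    have : S (hfin.toFinset.card + 1) z ⊆ hfin.toFinset := by
      intro U hU
      rw [Set.Finite.mem_toFinset]
      refine ⟨?_, hx U (Finset.mem_coe.2 hU)⟩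
      exact mem_iUnion.2 ⟨_, mem_iUnion₂.2 ⟨z, hz, Finset.mem_coe.2 hU⟩⟩
    have := Finset.card_le_card this
    rw [hc] at this
    omega

/-- The Hurewicz property. -/
def HurProp (α : Type*) [TopologicalSpace α] : Prop :=
  ∀ 𝒰 : ℕ → Set (Set α),
        (∀ n, IsOpenCover (𝒰 n) ∧ ¬ HasFinSubcover (𝒰 n)) →
        ∃ ℱ : ℕ → Set (Set α), (∀ n, (ℱ n).Finite ∧ ℱ n ⊆ 𝒰 n) ∧
          ∀ x : α, ∀ᶠ n in atTop, x ∈ ⋃₀ ℱ n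

theorem HurProp.all {α : Type*} [TopologicalSpace α] (H : HurProp α) (𝒰 : ℕ → Set (Set α))
    (h : ∀ n, IsOpenCover (𝒰 n)) :
    ∃ ℱ : ℕ → Set (Set α), (∀ n, (ℱ n).Finite ∧ ℱ n ⊆ 𝒰 n) ∧
          ∀ x : α, ∀ᶠ n in atTop, x ∈ ⋃₀ ℱ n := by
  classical
  by_cases hb : ∀ n, HasFinSubcover (𝒰 n)
  · choose F hF hf hu using hb
    exact ⟨F, fun n => ⟨hf n, hF n⟩, fun x => Eventually.of_forall fun n => by rw [hu]; trivial⟩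
  push Not at hb
  obtain ⟨m, hm⟩ := hb
  obtain ⟨F, hF, hx⟩ := H (fun n => if HasFinSubcover (𝒰 n) then 𝒰 m else 𝒰 n) (by
    intro n
    by_cases hn : HasFinSubcover (𝒰 n)
    · simp only [hn, if_true]; exact ⟨h m, hm⟩
    · rw [if_neg hn]; exact ⟨h n, hn⟩)
  have : ∀ n, ∃ G : Set (Set α), (G.Finite ∧ G ⊆ 𝒰 n) ∧ ∀ x, x ∈ ⋃₀ F n → x ∈ ⋃₀ G := by
    intro n
    by_cases hn : HasFinSubcover (𝒰 n)
    · obtain ⟨G, hG, hf, hu⟩ := hn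
      exact ⟨G, ⟨hf, hG⟩, fun x _ => by rw [hu]; trivial⟩
    · have := hF n
      simp only [hn, if_false] at this
      exact ⟨F n, this, fun x hx => hx⟩
  choose G hG hGx using this
  exact ⟨G, hG, fun x => (hx x).mono fun n hn => hGx n x hn⟩

theorem HurProp.countable {α : Type*} [TopologicalSpace α] (H : HurProp α)
    {ι : Type*} [Countable ι] [Nonempty ι] (𝒰 : ι → Set (Set α))
    (h : ∀ n, IsOpenCover (𝒰 n)) :
    ∃ ℱ : ι → Set (Set α), (∀ n, (ℱ n).Finite ∧ ℱ n ⊆ 𝒰 n) ∧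
          ∀ x : α, ∀ᶠ n in cofinite, x ∈ ⋃₀ ℱ n := by
  obtain ⟨g, hg⟩ := exists_surjective_nat ι
  obtain ⟨r, hr⟩ := hg.hasRightInverse
  obtain ⟨F, hF, hx⟩ := H.all (fun n => 𝒰 (g n)) (fun n => h _)
  refine ⟨fun i => F (r i), fun i => ?_, fun x => ?_⟩
  · have := hF (r i)
    simpa only [hr i] using this
  · have := hx x
    rw [← Nat.cofinite_eq_atTop] at this
    exact hr.injective.tendsto_cofinite.eventually this

theorem hur_forward {α : Type*} [TopologicalSpace α] [SecondCountableTopology α] (H : HurProp α)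
    (𝒰 : ℕ → Set (Set α)) (h : ∀ n, IsOmegaCover (𝒰 n)) :
    ∃ ℱ : ℕ → Set (Set α), (∀ n, (ℱ n).Finite ∧ ℱ n ⊆ 𝒰 n) ∧
      IsGammaGroupable (⋃ n, ℱ n) := by
  classical
  have h1 := fun n => countable_large (h n).1.2 (omega_large (h n))
  choose 𝒱 hV hVc hVl using h1
  have hC : (⋃ n, 𝒱 n).Countable := countable_iUnion hVc
  have : Countable (⋃ n, 𝒱 n : Set (Set α)) := hC.to_subtype
  -- index: pairs of a number and a finite set of members
  obtain ⟨F, hF, hFx⟩ := H.countable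
    (ι := ℕ × Finset (⋃ n, 𝒱 n : Set (Set α)))
    (fun p => 𝒱 p.1 \ ((fun U : (⋃ n, 𝒱 n : Set (Set α)) => (U : Set α)) '' (p.2 : Set _))) (by
      rintro ⟨n, A⟩
      refine ⟨⟨?_, fun hu => (h n).1.1.2 (hV n hu.1)⟩, fun U hU => (h n).1.2 U (hV n hU.1)⟩
      refine eq_univ_of_forall fun x => ?_
      obtain ⟨U, hU, hUA⟩ := (hVl n x).exists_notMem_finite
        (A.finite_toSet.image (fun U : (⋃ n, 𝒱 n : Set (Set α)) => (U : Set α)))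
      exact ⟨U, ⟨hU.1, hUA⟩, hU.2⟩)
  have step : ∀ p : ℕ × Finset (⋃ n, 𝒱 n : Set (Set α)),
      ∃ B : Finset (⋃ n, 𝒱 n : Set (Set α)), p.2 ⊆ B ∧
        F p ⊆ (fun U : (⋃ n, 𝒱 n : Set (Set α)) => (U : Set α)) '' (B : Set _) := by
    intro p
    have hf : ((fun U : (⋃ n, 𝒱 n : Set (Set α)) => (U : Set α)) ⁻¹' F p).Finite :=
      (hF p).1.preimage Subtype.val_injective.injOn
    refine ⟨p.2 ∪ hf.toFinset, Finset.subset_union_left, fun U hU => ?_⟩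
    refine ⟨⟨U, mem_iUnion.2 ⟨p.1, ((hF p).2 hU).1⟩⟩, ?_, rfl⟩
    simp [hU]
  choose B hB hFB using step
  let A : ℕ → Finset (⋃ n, 𝒱 n : Set (Set α)) := fun n => Nat.rec ∅ (fun n a => B (n, a)) n
  have hA : ∀ n, A (n + 1) = B (n, A n) := fun n => rfl
  have hmono : Monotone A := monotone_nat_of_le_succ fun n => by rw [hA]; exact hB (n, A n)
  have hdis : ∀ i n, i < n → Disjoint (F (i, A i)) (F (n, A n)) := by
    intro i n hin
    rw [Set.disjoint_left]
    intro U hUi hUn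
    obtain ⟨V, hV1, hV2⟩ := hFB (i, A i) hUi
    have h3 : A (i + 1) ⊆ A n := hmono hin
    exact ((hF (n, A n)).2 hUn).2 ⟨V, h3 hV1, hV2⟩
  have hev : ∀ x, ∀ᶠ n in atTop, x ∈ ⋃₀ F (n, A n) := by
    intro x
    have hinj : Function.Injective fun n => (n, A n) := fun a b hab => congrArg Prod.fst hab
    rw [← Nat.cofinite_eq_atTop]
    exact hinj.tendsto_cofinite.eventually (hFx x)
  refine ⟨fun n => F (n, A n), fun n => ⟨(hF _).1, fun U hU => hV n ((hF (n, A n)).2 hU).1⟩,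
    ⟨?_, ?_⟩, fun n => F (n, A n), fun n => (hF _).1, ?_, rfl, hev⟩
  · refine eq_univ_of_forall fun x => ?_
    obtain ⟨n, U, hU, hx⟩ := (hev x).exists
    exact ⟨U, mem_iUnion.2 ⟨n, hU⟩, hx⟩
  · intro hu
    obtain ⟨n, hn⟩ := mem_iUnion.1 hu
    exact (h n).1.1.2 (hV n ((hF (n, A n)).2 hn).1)
  · intro k l hkl
    rcases lt_or_gt_of_ne hkl with hlt | hlt
    · exact hdis k l hlt
    · exact (hdis l k hlt).symm

theorem exists_group_disjoint {β : Type*} (G : ℕ → Set β)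
    (hd : ∀ k l, k ≠ l → Disjoint (G k) (G l)) (S : Set β) (hS : S.Finite) (i : ℕ) :
    ∃ k, i ≤ k ∧ Disjoint (G k) S := by
  by_contra! hcon
  have h1 : ∀ k, ∃ s, s ∈ G (i + k) ∧ s ∈ S := fun k =>
    Set.not_disjoint_iff.1 (hcon (i + k) (Nat.le_add_right _ _))
  choose s hs hsS using h1
  have hinj : Function.Injective s := by
    intro a b hab
    by_contra hne
    exact Set.disjoint_left.1 (hd (i + a) (i + b) (by omega)) (hs a) (hab ▸ hs b)
  exact Set.infinite_of_injective_forall_mem hinj hsS hS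

theorem hur_backward {α : Type*} [TopologicalSpace α]
    (H : ∀ 𝒰 : ℕ → Set (Set α), (∀ n, IsOmegaCover (𝒰 n)) →
        ∃ ℱ : ℕ → Set (Set α), (∀ n, (ℱ n).Finite ∧ ℱ n ⊆ 𝒰 n) ∧
          IsGammaGroupable (⋃ n, ℱ n)) : HurProp α := by
  intro 𝒰 h
  obtain ⟨F, hF, -, G, hGf, hGd, hGu, hGx⟩ := H
    (fun n => {V | ∃ f : ℕ → Set (Set α), (∀ i, (f i).Finite ∧ f i ⊆ 𝒰 i) ∧
      V = ⋂ i ∈ Iic n, ⋃₀ f i}) (by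
    intro n
    have hfs : ∀ T : Set α, T.Finite → ∃ V ∈ {V | ∃ f : ℕ → Set (Set α),
        (∀ i, (f i).Finite ∧ f i ⊆ 𝒰 i) ∧ V = ⋂ i ∈ Iic n, ⋃₀ f i}, T ⊆ V := by
      intro T hT
      have hex : ∀ (i : ℕ) (x : α), ∃ U ∈ 𝒰 i, x ∈ U := fun i x => by
        have : x ∈ ⋃₀ 𝒰 i := by rw [(h i).1.1.1]; trivial
        exact this
      choose U hU hxU using hex
      refine ⟨_, ⟨fun i => U i '' T, fun i => ⟨hT.image _, ?_⟩, rfl⟩, ?_⟩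
      · rintro _ ⟨x, _, rfl⟩
        exact hU i x
      · intro x hx
        refine mem_iInter₂.2 fun i _ => ⟨U i x, mem_image_of_mem _ hx, hxU i x⟩
    refine ⟨⟨⟨?_, ?_⟩, ?_⟩, hfs⟩
    · refine eq_univ_of_forall fun x => ?_
      obtain ⟨V, hV, hx⟩ := hfs {x} (finite_singleton x)
      exact ⟨V, hV, hx rfl⟩
    · rintro ⟨f, hf, hu⟩
      refine (h n).2 ⟨f n, (hf n).2, (hf n).1, eq_univ_of_forall fun x => ?_⟩
      have hx : x ∈ ⋂ i ∈ Iic n, ⋃₀ f i := by rw [← hu]; trivial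
      exact mem_iInter₂.1 hx n (mem_Iic.2 le_rfl)
    · rintro _ ⟨f, hf, rfl⟩
      exact (finite_Iic n).isOpen_biInter fun i _ =>
        isOpen_sUnion fun U hU => (h i).1.2 U ((hf i).2 hU))
  have hk : ∀ i, ∃ k, i ≤ k ∧ Disjoint (G k) (⋃ n ∈ Iio i, F n) := fun i =>
    exists_group_disjoint G hGd _ ((finite_Iio i).biUnion fun n _ => (hF n).1) i
  choose k hik hkd using hk
  have hV : ∀ (i : ℕ) (V : Set α), ∃ E : Set (Set α), E.Finite ∧ E ⊆ 𝒰 i ∧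
      (V ∈ G (k i) → V ⊆ ⋃₀ E) := by
    intro i V
    by_cases hV : V ∈ G (k i)
    · have h1 : V ∈ ⋃ n, F n := hGu ▸ mem_iUnion.2 ⟨k i, hV⟩
      obtain ⟨n, hn⟩ := mem_iUnion.1 h1
      have hin : i ≤ n := by
        by_contra! hlt
        exact Set.disjoint_left.1 (hkd i) hV (mem_iUnion₂.2 ⟨n, hlt, hn⟩)
      obtain ⟨f, hf, rfl⟩ := (hF n).2 hn
      exact ⟨f i, (hf i).1, (hf i).2, fun _ x hx => mem_iInter₂.1 hx i hin⟩
    · exact ⟨∅, finite_empty, empty_subset _, fun h' => absurd h' hV⟩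
  choose E hEf hEs hE using hV
  refine ⟨fun i => ⋃ V ∈ G (k i), E i V, fun i => ⟨(hGf _).biUnion fun V _ => hEf i V,
    iUnion₂_subset fun V _ => hEs i V⟩, fun x => ?_⟩
  have hkt : Tendsto k atTop atTop := tendsto_atTop_mono hik tendsto_id
  refine (hkt.eventually (hGx x)).mono ?_
  rintro i ⟨V, hVG, hx⟩
  obtain ⟨U, hU, hxU⟩ := hE i V hVG hx
  exact ⟨U, mem_iUnion₂.2 ⟨V, hVG, hU⟩, hxU⟩

/-- For sets of reals, the Hurewicz property `Ufin(Γ,Γ)` is equivalent to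
`Sfin(Ω,O^{γ-gp})`. -/
theorem hurewicz_iff_sfin_omega_gammagroupable (X : Set ℝ) :
    (∀ 𝒰 : ℕ → Set (Set X),
        (∀ n, IsOpenCover (𝒰 n) ∧ ¬ HasFinSubcover (𝒰 n)) →
        ∃ ℱ : ℕ → Set (Set X), (∀ n, (ℱ n).Finite ∧ ℱ n ⊆ 𝒰 n) ∧
          ∀ x : X, ∀ᶠ n in atTop, x ∈ ⋃₀ ℱ n) ↔
    (∀ 𝒰 : ℕ → Set (Set X), (∀ n, IsOmegaCover (𝒰 n)) →
        ∃ ℱ : ℕ → Set (Set X), (∀ n, (ℱ n).Finite ∧ ℱ n ⊆ 𝒰 n) ∧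
          IsGammaGroupable (⋃ n, ℱ n)) := by
  exact ⟨fun H => hur_forward H, fun H => hur_backward H⟩
end
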